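/- Let H = (ℂ²)^{⊗w}, k ≤ w, and let Q be a unitary on H. For r ∈ {0,1}^{w-k} let ψ_r = |0⟩^{⊗k} ⊗ |r⟩, let Π_0 = |0⟩⟨0| ⊗ I^{⊗(w-1)}, and let Δ_0 = Σ_r |ψ_r⟩⟨ψ_r| = (|0⟩⟨0|)^{⊗k} ⊗ I^{⊗(w-k)}. Define p = 2^{-(w-k)} Σ_r ‖Π_0 Q ψ_r‖². Then p² ≤ 2^{-(w-k)} Σ_r ‖Δ_0 Q† Π_0 Q ψ_r‖² ≤ p. -/

import Mathlib

theorem aux_diag_apply {ι : Type*} [Fintype ι] [DecidableEq ι] (S : ι → Prop) [DecidablePred S]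
    (x : EuclideanSpace ℂ ι) (v : ι) :
    (Matrix.toEuclideanLin (Matrix.diagonal fun v => if S v then (1 : ℂ) else 0) x) v
      = if S v then x v else 0 := by
  simp [Matrix.toLpLin_apply, Matrix.mulVec_diagonal]

theorem aux_diag_norm {ι : Type*} [Fintype ι] [DecidableEq ι] (S : ι → Prop) [DecidablePred S]
    (x : EuclideanSpace ℂ ι) :
    ‖Matrix.toEuclideanLin (Matrix.diagonal fun v => if S v then (1 : ℂ) else 0) x‖ ^ 2
      ≤ ‖x‖ ^ 2 := by
  rw [EuclideanSpace.norm_sq_eq, EuclideanSpace.norm_sq_eq]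
  refine Finset.sum_le_sum fun v _ => ?_
  rw [aux_diag_apply]
  split_ifs <;> simp

theorem aux_diag_inner {ι : Type*} [Fintype ι] [DecidableEq ι] (S : ι → Prop) [DecidablePred S]
    (x : EuclideanSpace ℂ ι) :
    inner ℂ x (Matrix.toEuclideanLin (Matrix.diagonal fun v => if S v then (1 : ℂ) else 0) x)
      = ((‖Matrix.toEuclideanLin
          (Matrix.diagonal fun v => if S v then (1 : ℂ) else 0) x‖ ^ 2 : ℝ) : ℂ) := by
  have h := inner_self_eq_norm_sq_to_K (𝕜 := ℂ)
    (Matrix.toEuclideanLin (Matrix.diagonal fun v => if S v then (1 : ℂ) else 0) x)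
  push_cast
  refine Eq.trans ?_ h
  rw [PiLp.inner_apply, PiLp.inner_apply]
  refine Finset.sum_congr rfl fun v _ => ?_
  rw [aux_diag_apply]
  split_ifs <;> simp

theorem aux_adj {ι : Type*} [Fintype ι] [DecidableEq ι] (Q : Matrix ι ι ℂ)
    (x y : EuclideanSpace ℂ ι) :
    inner ℂ x (Matrix.toEuclideanLin Q.conjTranspose y)
      = inner ℂ (Matrix.toEuclideanLin Q x) y := by
  rw [Matrix.toEuclideanLin_conjTranspose_eq_adjoint, LinearMap.adjoint_inner_right]

theorem aux_unitary {ι : Type*} [Fintype ι] [DecidableEq ι] (Q : Matrix ι ι ℂ)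
    (hQ : Q ∈ Matrix.unitaryGroup ι ℂ) (x : EuclideanSpace ℂ ι) :
    ‖Matrix.toEuclideanLin Q.conjTranspose x‖ ^ 2 = ‖x‖ ^ 2 := by
  have h := aux_adj Q (Matrix.toEuclideanLin Q.conjTranspose x) x
  have h2 : Matrix.toEuclideanLin Q (Matrix.toEuclideanLin Q.conjTranspose x) = x := by
    have h3 : Q * Q.conjTranspose = 1 := Matrix.mem_unitaryGroup_iff.mp hQ
    simp [Matrix.toLpLin_apply, Matrix.mulVec_mulVec, h3]
  rw [h2, inner_self_eq_norm_sq_to_K, inner_self_eq_norm_sq_to_K] at h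
  exact_mod_cast h

theorem aux_lower {ι : Type*} [Fintype ι] [DecidableEq ι] (S T : ι → Prop) [DecidablePred S]
    [DecidablePred T] (Q : Matrix ι ι ℂ) (u : ι) (hu : T u) :
    (‖Matrix.toEuclideanLin (Matrix.diagonal fun v => if S v then (1 : ℂ) else 0)
        (Matrix.toEuclideanLin Q (EuclideanSpace.single u 1))‖ ^ 2) ^ 2 ≤
    ‖Matrix.toEuclideanLin (Matrix.diagonal fun v => if T v then (1 : ℂ) else 0)
      (Matrix.toEuclideanLin Q.conjTranspose
      (Matrix.toEuclideanLin (Matrix.diagonal fun v => if S v then (1 : ℂ) else 0)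
        (Matrix.toEuclideanLin Q (EuclideanSpace.single u 1))))‖ ^ 2 := by
  have h := aux_diag_inner S (Matrix.toEuclideanLin Q (EuclideanSpace.single u 1))
  rw [← aux_adj, EuclideanSpace.inner_single_left] at h
  simp only [map_one, one_mul] at h
  generalize Matrix.toEuclideanLin Q.conjTranspose
      (Matrix.toEuclideanLin (Matrix.diagonal fun v => if S v then (1 : ℂ) else 0)
        (Matrix.toEuclideanLin Q (EuclideanSpace.single u 1))) = y at *
  have h1 := PiLp.norm_apply_le
    (Matrix.toEuclideanLin (Matrix.diagonal fun v => if T v then (1 : ℂ) else 0) y) u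
  rw [aux_diag_apply, if_pos hu, h, Complex.norm_real, Real.norm_of_nonneg (by positivity)] at h1
  exact pow_le_pow_left₀ (by positivity) h1 2

theorem aux_avg (n : ℕ) (f g : (Fin n → Fin 2) → ℝ) (h : ∀ r, f r ^ 2 ≤ g r) :
    ((1 / 2 ^ n) * ∑ r, f r) ^ 2 ≤ (1 / 2 ^ n) * ∑ r, g r := by
  have h1 := sq_sum_le_card_mul_sum_sq (s := Finset.univ) (f := f)
  have h2 : ∑ r, f r ^ 2 ≤ ∑ r, g r := Finset.sum_le_sum fun r _ => h r
  simp only [Finset.card_univ, Fintype.card_pi, Fintype.card_fin, Finset.prod_const] at h1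
  push_cast at h1
  have h0 : (0 : ℝ) < 2 ^ n := by positivity
  calc ((1 / 2 ^ n) * ∑ r, f r) ^ 2 = (1 / 2 ^ n) ^ 2 * (∑ r, f r) ^ 2 := by ring
    _ ≤ (1 / 2 ^ n) ^ 2 * (2 ^ n * ∑ r, g r) := by
      gcongr
      exact h1.trans (by gcongr)
    _ = _ := by field_simp

/-- Let `H = (ℂ²)^{⊗w}` (Euclidean space indexed by `Fin w → Fin 2`), `k ≤ w`, and `Q` a
unitary on `H`.  For `r ∈ {0,1}^{w-k}` let `ψ r` be the computational basis vector whose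
first `k` qubits are `0` and whose remaining qubits are given by `r`; let
`P₀ = |0⟩⟨0| ⊗ I^{⊗(w-1)}` and `Δ₀ = (|0⟩⟨0|)^{⊗k} ⊗ I^{⊗(w-k)}` (diagonal matrices).
With `p = 2^{-(w-k)} Σ_r ‖P₀ Q ψ_r‖²`, it holds that
`p² ≤ 2^{-(w-k)} Σ_r ‖Δ₀ Q† P₀ Q ψ_r‖² ≤ p`. -/
theorem one_clean_qubit_simulation_bounds (w k : ℕ) (hw : 0 < w) (hk : k ≤ w)
    (Q : Matrix (Fin w → Fin 2) (Fin w → Fin 2) ℂ)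
    (hQ : Q ∈ Matrix.unitaryGroup (Fin w → Fin 2) ℂ) :
    let ψ : (Fin (w - k) → Fin 2) → EuclideanSpace ℂ (Fin w → Fin 2) := fun r =>
      EuclideanSpace.single
        (fun i => if h : (i : ℕ) < k then 0
          else r ⟨(i : ℕ) - k, by have := i.isLt; omega⟩) 1
    let P₀ : Matrix (Fin w → Fin 2) (Fin w → Fin 2) ℂ :=
      Matrix.diagonal fun v => if v ⟨0, hw⟩ = 0 then 1 else 0
    let Δ₀ : Matrix (Fin w → Fin 2) (Fin w → Fin 2) ℂ :=
      Matrix.diagonal fun v => if (∀ i : Fin w, (i : ℕ) < k → v i = 0) then 1 else 0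
    let p : ℝ := (1 / 2 ^ (w - k)) *
      ∑ r, ‖Matrix.toEuclideanLin P₀ (Matrix.toEuclideanLin Q (ψ r))‖ ^ 2
    p ^ 2 ≤ (1 / 2 ^ (w - k)) *
        ∑ r, ‖Matrix.toEuclideanLin Δ₀ (Matrix.toEuclideanLin Q.conjTranspose
          (Matrix.toEuclideanLin P₀ (Matrix.toEuclideanLin Q (ψ r))))‖ ^ 2 ∧
      (1 / 2 ^ (w - k)) *
        ∑ r, ‖Matrix.toEuclideanLin Δ₀ (Matrix.toEuclideanLin Q.conjTranspose
          (Matrix.toEuclideanLin P₀ (Matrix.toEuclideanLin Q (ψ r))))‖ ^ 2 ≤ p := by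
  intro ψ P₀ Δ₀ p
  refine ⟨aux_avg _ _ _ fun r => ?_, ?_⟩
  · refine aux_lower _ _ Q _ ?_
    intro i hi
    simp [hi]
  · refine mul_le_mul_of_nonneg_left (Finset.sum_le_sum fun r _ => ?_) (by positivity)
    refine (aux_diag_norm _ _).trans ?_
    rw [aux_unitary Q hQ]
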